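/- arXiv:2207.12719 — 2 statements merged into one kernel-verified Lean document; each statement's English description precedes it below -/
import Mathlib

section
/- Let C ⊆ M³ˣ³_sym be a nonempty closed convex set insensitive to hydrostatic pressure, σ ∈ C, and g₁, g₂ ∈ M³ˣ³_sym nonzero and not collinear such that T_C(σ) = {φ ∈ M³ˣ³_sym : φ:g₁ ≤ 0 and φ:g₂ ≤ 0}. Let λ > 0, μ > 0, H(τ) = 2μτ + λ tr(τ)I. For ε̇ ∈ M³ˣ³_sym set aᵢ = (ε̇:gᵢ)/‖gᵢ‖ (i = 1,2), δ = (g₁:g₂)/(‖g₁‖·‖g₂‖), η₁ = (a₁ − δa₂)/(1 − δ²), η₂ = (a₂ − δa₁)/(1 − δ²), and let ε̇^p = η₁ g₁/‖g₁‖ + η₂ g₂/‖g₂‖ if η₁ ≥ 0 and η₂ ≥ 0; ε̇^p = max(a₁, 0)·g₁/‖g₁‖ if min(η₁, η₂) < 0 and a₁ ≥ a₂; ε̇^p = max(a₂, 0)·g₂/‖g₂‖ if min(η₁, η₂) < 0 and a₁ ≤ a₂. Then P_{N_C(σ)}(ε̇) = ε̇^p, P_{T_C(σ)}(ε̇) =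 ε̇ − ε̇^p, and P_{T_C(σ)}(H(ε̇)) = λ tr(ε̇) I + 2μ ε̇ − 2μ ε̇^p. -/
open Matrix

/-- The space of 3×3 real matrices (we single out the symmetric ones by `Matrix.IsSymm`). -/
abbrev Mat3 := Matrix (Fin 3) (Fin 3) ℝ

/-- The Frobenius inner product on symmetric matrices: `σ:τ = tr(στ)`. -/
noncomputable def minner (A B : Mat3) : ℝ := (A * B).trace

/-- The Frobenius norm `‖A‖ = (A:A)^{1/2}` on symmetric matrices. -/
noncomputable def mnorm (A : Mat3) : ℝ := Real.sqrt (minner A A)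

/-- `p` is the metric (orthogonal) projection of `z` onto `K`. -/
def IsProjOn (K : Set Mat3) (z p : Mat3) : Prop :=
  p ∈ K ∧ ∀ w ∈ K, mnorm (z - p) ≤ mnorm (z - w)

/-- The tangent cone of a convex set `C` at `σ`. -/
def tangentCone (C : Set Mat3) (σ : Mat3) : Set Mat3 :=
  closure {τ | ∃ η ∈ C, ∃ α : ℝ, 0 < α ∧ τ = α • (η - σ)}

/-- The normal cone of a convex set `C ⊆ M³ˣ³_sym` at `σ`. -/
def normalCone (C : Set Mat3) (σ : Mat3) : Set Mat3 :=
  {n | n.IsSymm ∧ ∀ τ ∈ tangentCone C σ, minner n τ ≤ 0}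

/-- The Hooke (isotropic elasticity) operator `H(τ) = 2μτ + λ tr(τ) I`. -/
noncomputable def hooke (lam mu : ℝ) (τ : Mat3) : Mat3 :=
  (2 * mu) • τ + (lam * τ.trace) • (1 : Mat3)


lemma minner_comm' (A B : Mat3) : minner A B = minner B A := by
  unfold minner; exact Matrix.trace_mul_comm A B

lemma minner_add_l (A B D : Mat3) : minner (A + B) D = minner A D + minner B D := by
  simp [minner, add_mul]

lemma minner_sub_l (A B D : Mat3) : minner (A - B) D = minner A D - minner B D := by
  simp [minner, sub_mul]

lemma minner_smul_l (c : ℝ) (A D : Mat3) : minner (c • A) D = c * minner A D := by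
  simp [minner]

lemma minner_add_r (A B D : Mat3) : minner D (A + B) = minner D A + minner D B := by
  simp [minner, mul_add]

lemma minner_sub_r (A B D : Mat3) : minner D (A - B) = minner D A - minner D B := by
  simp [minner, mul_sub]

lemma minner_smul_r (c : ℝ) (A D : Mat3) : minner D (c • A) = c * minner D A := by
  simp [minner]

lemma minner_self_eq (A : Mat3) (h : A.IsSymm) : minner A A = ∑ i, ∑ j, A i j ^ 2 := by
  unfold minner
  simp only [Matrix.trace, Matrix.diag, Matrix.mul_apply]
  refine Finset.sum_congr rfl fun i _ => Finset.sum_congr rfl fun j _ => ?_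
  rw [h.apply i j]; ring

lemma minner_self_nonneg (A : Mat3) (h : A.IsSymm) : 0 ≤ minner A A := by
  rw [minner_self_eq A h]; positivity

lemma minner_self_pos (A : Mat3) (h : A.IsSymm) (h0 : A ≠ 0) : 0 < minner A A := by
  refine lt_of_le_of_ne (minner_self_nonneg A h) fun h1 => h0 ?_
  rw [minner_self_eq A h] at h1
  ext i j
  have h2 := (Finset.sum_eq_zero_iff_of_nonneg
    (fun i _ => Finset.sum_nonneg fun j _ => sq_nonneg (A i j))).1 h1.symm i (Finset.mem_univ i)
  have h3 := (Finset.sum_eq_zero_iff_of_nonneg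
    (fun j _ => sq_nonneg (A i j))).1 h2 j (Finset.mem_univ j)
  simpa using h3

/-- Variational characterization of projections, sufficient direction. -/
lemma isProjOn_of (K : Set Mat3) (hK : ∀ A ∈ K, A.IsSymm) (z p : Mat3)
    (hp : p ∈ K) (h0 : minner (z - p) p = 0) (h : ∀ w ∈ K, minner (z - p) w ≤ 0) :
    IsProjOn K z p := by
  refine ⟨hp, fun w hw => Real.sqrt_le_sqrt ?_⟩
  have e : z - w = (z - p) + (p - w) := by abel
  have h1 := h w hw
  have h2 := minner_self_nonneg (p - w) ((hK p hp).sub (hK w hw))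
  rw [e, minner_add_l, minner_add_r, minner_add_r, minner_comm' (p - w) (z - p),
    minner_sub_r p w (z - p)]
  linarith

/-- The scalar complementarity system in the case `a₂ ≤ a₁`. -/
lemma scalar_case (a₁ a₂ δ : ℝ) (hδ : δ ^ 2 < 1) (h : a₂ ≤ a₁)
    (hm : a₁ - δ * a₂ < 0 ∨ a₂ - δ * a₁ < 0) :
    a₁ - max a₁ 0 ≤ 0 ∧ a₂ - δ * max a₁ 0 ≤ 0 ∧ max a₁ 0 * (a₁ - max a₁ 0) = 0 := by
  have hδ' := abs_lt.1 ((sq_lt_one_iff_abs_lt_one δ).1 hδ)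
  rcases le_total a₁ 0 with h1 | h1
  · rw [max_eq_right h1]; refine ⟨by linarith, by linarith, by ring⟩
  · rw [max_eq_left h1]; refine ⟨by linarith, ?_, by ring⟩
    rcases hm with hm | hm
    · rcases le_total a₂ 0 with h2 | h2
      · have hd : δ ≤ 0 := by
          by_contra hc
          push Not at hc
          nlinarith
        nlinarith
      · nlinarith
    · exact hm.le

/-- The three projections from the complementarity system. -/
lemma core (C : Set Mat3)
    (hhydro : ∀ A ∈ C, ∀ p : ℝ, A + p • (1 : Mat3) ∈ C)
    (σ : Mat3) (hσ : σ ∈ C)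
    (g₁ g₂ : Mat3) (hg₁sym : g₁.IsSymm) (hg₂sym : g₂.IsSymm)
    (htg : tangentCone C σ = {φ : Mat3 | φ.IsSymm ∧ minner φ g₁ ≤ 0 ∧ minner φ g₂ ≤ 0})
    (lam mu : ℝ) (hmu : 0 < mu)
    (ε' : Mat3) (hε' : ε'.IsSymm) (εp : Mat3) (c₁ c₂ : ℝ) (hc₁ : 0 ≤ c₁) (hc₂ : 0 ≤ c₂)
    (he : εp = c₁ • g₁ + c₂ • g₂)
    (h1 : minner (ε' - εp) g₁ ≤ 0) (h2 : minner (ε' - εp) g₂ ≤ 0)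
    (h3 : c₁ * minner (ε' - εp) g₁ = 0) (h4 : c₂ * minner (ε' - εp) g₂ = 0) :
    IsProjOn (normalCone C σ) ε' εp ∧
    IsProjOn (tangentCone C σ) ε' (ε' - εp) ∧
    IsProjOn (tangentCone C σ) (hooke lam mu ε')
      ((lam * ε'.trace) • (1 : Mat3) + (2 * mu) • ε' - (2 * mu) • εp) := by
  have hps : εp.IsSymm := by rw [he]; exact (hg₁sym.smul c₁).add (hg₂sym.smul c₂)
  have hI : ∀ p : ℝ, p • (1 : Mat3) ∈ tangentCone C σ := fun p =>
    subset_closure ⟨σ + p • (1 : Mat3), hhydro σ hσ p, 1, one_pos, by simp⟩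
  have hTsym : ∀ A ∈ tangentCone C σ, A.IsSymm := fun A hA => by rw [htg] at hA; exact hA.1
  have hI1 : minner 1 g₁ = 0 := by
    have x := hI 1
    have y := hI (-1)
    rw [htg] at x y
    have x := x.2.1
    have y := y.2.1
    rw [minner_smul_l] at x y
    linarith
  have hI2 : minner 1 g₂ = 0 := by
    have x := hI 1
    have y := hI (-1)
    rw [htg] at x y
    have x := x.2.2
    have y := y.2.2
    rw [minner_smul_l] at x y
    linarith
  have hneg : ∀ τ ∈ tangentCone C σ, minner εp τ ≤ 0 := fun τ hτ => by
    rw [htg] at hτ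
    obtain ⟨-, x, y⟩ := hτ
    rw [he, minner_add_l, minner_smul_l, minner_smul_l, minner_comm' g₁, minner_comm' g₂]
    nlinarith
  have ht : ε' - εp ∈ tangentCone C σ := by
    rw [htg]; exact ⟨hε'.sub hps, h1, h2⟩
  have h0 : minner (ε' - εp) εp = 0 := by
    conv_lhs => rw [he, minner_add_r, minner_smul_r, minner_smul_r, ← he]
    linarith
  have hI0 : minner εp 1 = 0 := by
    rw [he, minner_add_l, minner_smul_l, minner_smul_l, minner_comm' g₁, minner_comm' g₂, hI1, hI2]
    ring
  refine ⟨?_, ?_, ?_⟩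
  · refine isProjOn_of _ (fun A hA => hA.1) _ _ ⟨hps, hneg⟩ h0 fun w hw => ?_
    rw [minner_comm']; exact hw.2 _ ht
  · refine isProjOn_of _ hTsym _ _ ht ?_ ?_
    · rw [sub_sub_cancel, minner_comm']; exact h0
    · rw [sub_sub_cancel]; exact hneg
  · have e : hooke lam mu ε' -
        ((lam * ε'.trace) • (1 : Mat3) + (2 * mu) • ε' - (2 * mu) • εp) = (2 * mu) • εp := by
      unfold hooke; abel
    have e2 : (lam * ε'.trace) • (1 : Mat3) + (2 * mu) • ε' - (2 * mu) • εp
        = (lam * ε'.trace) • (1 : Mat3) + (2 * mu) • (ε' - εp) := by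
      rw [smul_sub]; abel
    refine isProjOn_of _ hTsym _ _ ?_ ?_ ?_
    · rw [htg, e2]
      refine ⟨(Matrix.isSymm_one.smul _).add ((hε'.sub hps).smul _), ?_, ?_⟩
      · rw [minner_add_l, minner_smul_l, minner_smul_l, hI1]; nlinarith
      · rw [minner_add_l, minner_smul_l, minner_smul_l, hI2]; nlinarith
    · rw [e, e2, minner_smul_l, minner_add_r, minner_smul_r, minner_smul_r, hI0, minner_comm' εp, h0]
      ring
    · intro w hw
      rw [e, minner_smul_l]
      have := hneg w hw
      nlinarith

/-- Theorem 3.3 (two saturated yield functions): explicit constitutive laws when the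
tangent cone at `σ` is the intersection of the two half-spaces determined by two
non-collinear gradients `g₁, g₂`. -/
theorem stmt11 (C : Set Mat3)
    (hCsym : ∀ A ∈ C, A.IsSymm) (hne : C.Nonempty) (hcl : IsClosed C) (hconv : Convex ℝ C)
    (hhydro : ∀ A ∈ C, ∀ p : ℝ, A + p • (1 : Mat3) ∈ C)
    (σ : Mat3) (hσ : σ ∈ C)
    (g₁ g₂ : Mat3) (hg₁sym : g₁.IsSymm) (hg₂sym : g₂.IsSymm)
    (hg₁ : g₁ ≠ 0) (hg₂ : g₂ ≠ 0) (hncol : ∀ c : ℝ, g₂ ≠ c • g₁)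
    (htg : tangentCone C σ = {φ : Mat3 | φ.IsSymm ∧ minner φ g₁ ≤ 0 ∧ minner φ g₂ ≤ 0})
    (lam mu : ℝ) (hlam : 0 < lam) (hmu : 0 < mu)
    (ε' : Mat3) (hε' : ε'.IsSymm)
    (a₁ a₂ δ η₁ η₂ : ℝ)
    (ha₁ : a₁ = minner ε' g₁ / mnorm g₁) (ha₂ : a₂ = minner ε' g₂ / mnorm g₂)
    (hδ : δ = minner g₁ g₂ / (mnorm g₁ * mnorm g₂))
    (hη₁ : η₁ = (a₁ - δ * a₂) / (1 - δ ^ 2))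
    (hη₂ : η₂ = (a₂ - δ * a₁) / (1 - δ ^ 2))
    (εp : Mat3)
    (hεpA : 0 ≤ η₁ → 0 ≤ η₂ → εp = (η₁ / mnorm g₁) • g₁ + (η₂ / mnorm g₂) • g₂)
    (hεpB : min η₁ η₂ < 0 → a₂ ≤ a₁ → εp = (max a₁ 0 / mnorm g₁) • g₁)
    (hεpC : min η₁ η₂ < 0 → a₁ ≤ a₂ → εp = (max a₂ 0 / mnorm g₂) • g₂) :
    IsProjOn (normalCone C σ) ε' εp ∧
    IsProjOn (tangentCone C σ) ε' (ε' - εp) ∧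
    IsProjOn (tangentCone C σ) (hooke lam mu ε')
      ((lam * ε'.trace) • (1 : Mat3) + (2 * mu) • ε' - (2 * mu) • εp) := by
  have hs1 := minner_self_pos g₁ hg₁sym hg₁
  have hs2 := minner_self_pos g₂ hg₂sym hg₂
  have hn1 : 0 < mnorm g₁ := Real.sqrt_pos.2 hs1
  have hn2 : 0 < mnorm g₂ := Real.sqrt_pos.2 hs2
  have hq1 : minner g₁ g₁ = mnorm g₁ ^ 2 := (Real.sq_sqrt hs1.le).symm
  have hq2 : minner g₂ g₂ = mnorm g₂ ^ 2 := (Real.sq_sqrt hs2.le).symm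
  have hb1 : minner ε' g₁ = a₁ * mnorm g₁ := by rw [ha₁]; field_simp
  have hb2 : minner ε' g₂ = a₂ * mnorm g₂ := by rw [ha₂]; field_simp
  have h12 : minner g₁ g₂ = δ * (mnorm g₁ * mnorm g₂) := by rw [hδ]; field_simp
  have hδ1 : δ ^ 2 < 1 := by
    have hv := minner_self_pos (g₂ - (δ * mnorm g₂ / mnorm g₁) • g₁)
      (hg₂sym.sub (hg₁sym.smul _)) (sub_ne_zero.2 (hncol _))
    rw [minner_sub_l, minner_sub_r, minner_sub_r, minner_smul_l, minner_smul_l, minner_smul_r,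
      minner_smul_r, minner_comm' g₂ g₁, h12, hq1, hq2] at hv
    have e : mnorm g₂ ^ 2 - δ * mnorm g₂ / mnorm g₁ * (δ * (mnorm g₁ * mnorm g₂)) -
        (δ * mnorm g₂ / mnorm g₁ * (δ * (mnorm g₁ * mnorm g₂)) -
          δ * mnorm g₂ / mnorm g₁ * (δ * mnorm g₂ / mnorm g₁ * mnorm g₁ ^ 2))
        = mnorm g₂ ^ 2 * (1 - δ ^ 2) := by field_simp; ring
    have hv' : 0 < mnorm g₂ ^ 2 * (1 - δ ^ 2) := by linarith
    have := (pos_iff_pos_of_mul_pos hv').1 (by positivity)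
    linarith
  have hd : 0 < 1 - δ ^ 2 := by linarith
  have key : ∀ x y : ℝ, 0 ≤ x → 0 ≤ y → εp = (x / mnorm g₁) • g₁ + (y / mnorm g₂) • g₂ →
      a₁ - x - δ * y ≤ 0 → a₂ - δ * x - y ≤ 0 → x * (a₁ - x - δ * y) = 0 →
      y * (a₂ - δ * x - y) = 0 →
      IsProjOn (normalCone C σ) ε' εp ∧
      IsProjOn (tangentCone C σ) ε' (ε' - εp) ∧
      IsProjOn (tangentCone C σ) (hooke lam mu ε')
        ((lam * ε'.trace) • (1 : Mat3) + (2 * mu) • ε' - (2 * mu) • εp) := by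
    intro x y hx hy he k1 k2 k3 k4
    have m1 : minner (ε' - εp) g₁ = mnorm g₁ * (a₁ - x - δ * y) := by
      rw [he, minner_sub_l, minner_add_l, minner_smul_l, minner_smul_l, minner_comm' g₂ g₁,
        h12, hq1, hb1]
      field_simp
      ring
    have m2 : minner (ε' - εp) g₂ = mnorm g₂ * (a₂ - δ * x - y) := by
      rw [he, minner_sub_l, minner_add_l, minner_smul_l, minner_smul_l, h12, hq2, hb2]
      field_simp
      ring
    refine core C hhydro σ hσ g₁ g₂ hg₁sym hg₂sym htg lam mu hmu ε' hε' εp _ _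
      (by positivity) (by positivity) he ?_ ?_ ?_ ?_
    · rw [m1]; exact mul_nonpos_of_nonneg_of_nonpos hn1.le k1
    · rw [m2]; exact mul_nonpos_of_nonneg_of_nonpos hn2.le k2
    · rw [m1, ← k3]; field_simp
    · rw [m2, ← k4]; field_simp
  by_cases hA : 0 ≤ η₁ ∧ 0 ≤ η₂
  · have e1 : a₁ - η₁ - δ * η₂ = 0 := by
      rw [hη₁, hη₂]; field_simp; ring
    have e2 : a₂ - δ * η₁ - η₂ = 0 := by
      rw [hη₁, hη₂]; field_simp; ring
    exact key η₁ η₂ hA.1 hA.2 (hεpA hA.1 hA.2) e1.le e2.le (by rw [e1, mul_zero])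
      (by rw [e2, mul_zero])
  · have hmin : min η₁ η₂ < 0 := by
      rw [min_lt_iff]
      by_contra hc
      push Not at hc
      exact hA hc
    have hm : a₁ - δ * a₂ < 0 ∨ a₂ - δ * a₁ < 0 := by
      rcases min_lt_iff.1 hmin with h | h
      · left
        by_contra hc
        push Not at hc
        rw [hη₁] at h
        exact absurd (div_nonneg hc hd.le) (not_le.2 h)
      · right
        by_contra hc
        push Not at hc
        rw [hη₂] at h
        exact absurd (div_nonneg hc hd.le) (not_le.2 h)
    rcases le_total a₂ a₁ with h | h
    · obtain ⟨s1, s2, s3⟩ := scalar_case a₁ a₂ δ hδ1 h hm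
      exact key (max a₁ 0) 0 (le_max_right _ _) le_rfl (by rw [hεpB hmin h]; simp)
        (by linarith) (by linarith) (by linear_combination s3) (by ring)
    · obtain ⟨s1, s2, s3⟩ := scalar_case a₂ a₁ δ hδ1 h hm.symm
      exact key 0 (max a₂ 0) le_rfl (le_max_right _ _) (by rw [hεpC hmin h]; simp)
        (by linarith) (by linarith) (by ring) (by linear_combination s3)
end

section
/- Let k > 0 and C_T = {τ ∈ M³ˣ³_sym : λ₁(τ) − λ₃(τ) ≤ 2k}. Let σ ∈ M³ˣ³_sym with λ₁(σ) = λ₂(σ) > λ₃(σ) and λ₁(σ) − λ₃(σ) = 2k, and let v₃ be a unit eigenvector of σ for λ₃(σ). Then N_{C_T}(σ) = {κ − tr(κ)·v₃v₃ᵀ : κ ∈ M³ˣ³_sym, κ positive semidefinite, κv₃ = 0}. -/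
open Matrix

/-- The set of (real) eigenvalues of `A`, i.e. the real roots of `det(A - t I) = 0`. -/
def eigSet (A : Mat3) : Set ℝ := {t : ℝ | (A - t • (1 : Mat3)).det = 0}

/-- The largest eigenvalue `λ₁(A)` of `A`. -/
noncomputable def lam1 (A : Mat3) : ℝ := sSup (eigSet A)

/-- The smallest eigenvalue `λ₃(A)` of `A`. -/
noncomputable def lam3 (A : Mat3) : ℝ := sInf (eigSet A)

/-- The middle eigenvalue `λ₂(A)` of `A` (recovered from the trace). -/
noncomputable def lam2 (A : Mat3) : ℝ := A.trace - lam1 A - lam3 A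


theorem mem_eigSet_iff (A : Mat3) (t : ℝ) : t ∈ eigSet A ↔ ∃ v : Fin 3 → ℝ, v ≠ 0 ∧ A *ᵥ v = t • v := by
  unfold eigSet
  rw [Set.mem_ofPred_eq, ← Matrix.exists_mulVec_eq_zero_iff]
  simp only [sub_mulVec, smul_mulVec, one_mulVec, sub_eq_zero]

theorem eigSet_eq_spectrum (A : Mat3) : eigSet A = spectrum ℝ A := by
  ext t
  rw [spectrum.mem_iff, Matrix.isUnit_iff_isUnit_det, isUnit_iff_ne_zero, not_not,
    Algebra.algebraMap_eq_smul_one, ← neg_sub, Matrix.det_neg]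
  simp [eigSet]

theorem symm_herm {A : Mat3} (h : A.IsSymm) : A.IsHermitian := by
  unfold Matrix.IsHermitian
  rw [conjTranspose_eq_transpose_of_trivial]
  exact h

theorem eigSet_finite (A : Mat3) : (eigSet A).Finite := by
  rw [eigSet_eq_spectrum]; exact Matrix.finite_real_spectrum

theorem eigSet_nonempty {A : Mat3} (h : A.IsSymm) : (eigSet A).Nonempty := by
  rw [eigSet_eq_spectrum]
  exact ⟨_, (symm_herm h).eigenvalues_mem_spectrum_real 0⟩

theorem symm_one : (1 : Mat3).IsSymm := Matrix.transpose_one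

theorem lam1_psd {A : Mat3} (h : A.IsSymm) : (lam1 A • (1 : Mat3) - A).PosSemidef := by
  have hs : (lam1 A • (1 : Mat3) - A).IsSymm := (symm_one.smul _).sub h
  rw [(symm_herm hs).posSemidef_iff_eigenvalues_nonneg]
  intro i
  have := (symm_herm hs).eigenvalues_mem_spectrum_real i
  rw [← eigSet_eq_spectrum, mem_eigSet_iff] at this
  obtain ⟨v, hv, he⟩ := this
  have h2 : lam1 A - (symm_herm hs).eigenvalues i ∈ eigSet A := by
    rw [mem_eigSet_iff]
    refine ⟨v, hv, ?_⟩
    rw [sub_mulVec, smul_mulVec, one_mulVec] at he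
    rw [sub_smul, ← he]; abel
  have := le_csSup (eigSet_finite A).bddAbove h2
  change _ ≤ lam1 A at this
  simp only [Pi.zero_apply]
  linarith

theorem lam3_psd {A : Mat3} (h : A.IsSymm) : (A - lam3 A • (1 : Mat3)).PosSemidef := by
  have hs : (A - lam3 A • (1 : Mat3)).IsSymm := h.sub (symm_one.smul _)
  rw [(symm_herm hs).posSemidef_iff_eigenvalues_nonneg]
  intro i
  have := (symm_herm hs).eigenvalues_mem_spectrum_real i
  rw [← eigSet_eq_spectrum, mem_eigSet_iff] at this
  obtain ⟨v, hv, he⟩ := this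
  have h2 : lam3 A + (symm_herm hs).eigenvalues i ∈ eigSet A := by
    rw [mem_eigSet_iff]
    refine ⟨v, hv, ?_⟩
    rw [sub_mulVec, smul_mulVec, one_mulVec] at he
    rw [add_smul, ← he]; abel
  have := csInf_le (eigSet_finite A).bddBelow h2
  change lam3 A ≤ _ at this
  simp only [Pi.zero_apply]
  linarith

open scoped MatrixOrder ComplexOrder Matrix.Norms.L2Operator in
theorem psd_factor {A : Mat3} (h : A.PosSemidef) : ∃ B : Mat3, A = Bᴴ * B :=
  CStarAlgebra.nonneg_iff_eq_star_mul_self.mp h.nonneg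

theorem trace_mul_psd {A B : Mat3} (hA : A.PosSemidef) (hB : B.PosSemidef) :
    0 ≤ (A * B).trace := by
  obtain ⟨R, rfl⟩ := psd_factor hA
  rw [Matrix.mul_assoc, Matrix.trace_mul_comm]
  exact (hB.mul_mul_conjTranspose_same R).trace_nonneg

theorem proj_eig {k a : ℝ} (hk : 0 < k) {Q : Mat3} (hQ : Q.IsSymm) (hQ2 : Q * Q = Q) :
    (a • (1 : Mat3) - (2 * k) • Q).IsSymm ∧
      lam1 (a • (1 : Mat3) - (2 * k) • Q) - lam3 (a • (1 : Mat3) - (2 * k) • Q) ≤ 2 * k := by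
  have hs : (a • (1 : Mat3) - (2 * k) • Q).IsSymm := (symm_one.smul _).sub (hQ.smul _)
  refine ⟨hs, ?_⟩
  have key : ∀ t ∈ eigSet (a • (1 : Mat3) - (2 * k) • Q), t = a ∨ t = a - 2 * k := by
    intro t ht
    rw [mem_eigSet_iff] at ht
    obtain ⟨v, hv, he⟩ := ht
    rw [sub_mulVec, smul_mulVec, one_mulVec, smul_mulVec] at he
    have h1 := congrArg (Q *ᵥ ·) he
    simp only [mulVec_sub, mulVec_smul, mulVec_mulVec, hQ2] at h1
    have h2 : (a - 2 * k - t) • (Q *ᵥ v) = 0 := by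
      rw [sub_smul, sub_smul, h1, sub_self]
    rcases smul_eq_zero.mp h2 with h3 | h3
    · right; linarith
    · left
      rw [h3, smul_zero, sub_zero] at he
      have : (a - t) • v = 0 := by rw [sub_smul, he, sub_self]
      rcases smul_eq_zero.mp this with h4 | h4
      · linarith
      · exact absurd h4 hv
  have l1 : lam1 (a • (1 : Mat3) - (2 * k) • Q) ≤ a := by
    apply csSup_le (eigSet_nonempty hs)
    intro t ht
    rcases key t ht with h | h <;> linarith
  have l3 : a - 2 * k ≤ lam3 (a • (1 : Mat3) - (2 * k) • Q) := by
    apply le_csInf (eigSet_nonempty hs)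
    intro t ht
    rcases key t ht with h | h <;> linarith
  linarith

theorem vv_symm (v : Fin 3 → ℝ) : (vecMulVec v v).IsSymm := transpose_vecMulVec v v

theorem trace_mul_vv (n : Mat3) (v : Fin 3 → ℝ) : (n * vecMulVec v v).trace = v ⬝ᵥ (n *ᵥ v) := by
  rw [mul_vecMulVec, trace_vecMulVec, dotProduct_comm]

theorem vv_idem {v : Fin 3 → ℝ} (h : v ⬝ᵥ v = 1) : vecMulVec v v * vecMulVec v v = vecMulVec v v := by
  rw [mul_vecMulVec, vecMulVec_mulVec, h]; simp

theorem mul_vv_eq_zero {κ : Mat3} {v : Fin 3 → ℝ} (h : κ *ᵥ v = 0) : κ * vecMulVec v v = 0 := by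
  rw [mul_vecMulVec, h, zero_vecMulVec]

theorem vv_mul_eq_zero {κ : Mat3} {v : Fin 3 → ℝ} (hs : κ.IsSymm) (h : κ *ᵥ v = 0) :
    vecMulVec v v * κ = 0 := by
  rw [vecMulVec_mul, ← mulVec_transpose, hs, h, vecMulVec_zero]

theorem sigma_eq {σ : Mat3} (hσsym : σ.IsSymm)
    (h12 : lam1 σ = lam2 σ) {v : Fin 3 → ℝ} (hv : σ *ᵥ v = lam3 σ • v) (hu : v ⬝ᵥ v = 1) :
    σ = lam1 σ • (1 : Mat3) - (lam1 σ - lam3 σ) • vecMulVec v v := by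
  set P := vecMulVec v v with hP
  set M := lam1 σ • (1 : Mat3) - σ with hM
  have hMs : M.IsSymm := (symm_one.smul _).sub hσsym
  have hMP : M * P = (lam1 σ - lam3 σ) • P := by
    rw [hP, mul_vecMulVec, hM, sub_mulVec, smul_mulVec, one_mulVec, hv, ← sub_smul, smul_vecMulVec]
  have hPM : P * M = (lam1 σ - lam3 σ) • P := by
    have := congrArg Matrix.transpose hMP
    rwa [transpose_mul, hMs, transpose_smul, (vv_symm v : Pᵀ = P)] at this
  have hPP : P * P = P := vv_idem hu
  have h1 := (lam1_psd hσsym).conjTranspose_mul_mul_same (1 - P)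
  have h2 : (1 - P)ᴴ = 1 - P := symm_herm (symm_one.sub (vv_symm v))
  rw [h2, ← hM] at h1
  have h3 : (1 - P) * M * (1 - P) = M - (lam1 σ - lam3 σ) • P := by
    rw [sub_mul, one_mul, hPM, mul_sub, mul_one, sub_mul, hMP, smul_mul_assoc, hPP]
    simp
  rw [h3] at h1
  have h4 : (M - (lam1 σ - lam3 σ) • P).trace = 0 := by
    rw [hM, trace_sub, trace_sub, trace_smul, trace_smul, trace_one, hP, trace_vecMulVec, hu]
    unfold lam2 at h12
    simp only [Fintype.card_fin, smul_eq_mul]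
    push_cast
    linarith
  have h5 := h1.trace_eq_zero_iff.mp h4
  rw [← sub_eq_zero.mp h5, hM]; abel

theorem minner_cont (n : Mat3) : Continuous (fun τ : Mat3 => minner n τ) := by
  unfold minner
  exact (continuous_const.matrix_mul continuous_id).matrix_trace

theorem stmt16 (k : ℝ) (hk : 0 < k)
    (C : Set Mat3) (hC : C = {τ : Mat3 | τ.IsSymm ∧ lam1 τ - lam3 τ ≤ 2 * k})
    (σ : Mat3) (hσsym : σ.IsSymm)
    (h12 : lam1 σ = lam2 σ) (h23 : lam3 σ < lam2 σ) (hσbd : lam1 σ - lam3 σ = 2 * k)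
    (v₃ : Fin 3 → ℝ) (hv₃ : σ *ᵥ v₃ = lam3 σ • v₃) (hv₃u : v₃ ⬝ᵥ v₃ = 1) :
    normalCone C σ =
      {x : Mat3 | ∃ κ : Mat3, κ.IsSymm ∧ κ.PosSemidef ∧ κ *ᵥ v₃ = 0 ∧
        x = κ - κ.trace • vecMulVec v₃ v₃} := by
  have hσ := sigma_eq hσsym h12 hv₃ hv₃u
  rw [hσbd] at hσ
  have hPP := vv_idem hv₃u
  have hPs := vv_symm v₃
  set P := vecMulVec v₃ v₃ with hP
  ext n
  constructor
  · rintro ⟨hns, hn⟩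
    have key : ∀ s : ℝ, ∀ Q : Mat3, Q.IsSymm → Q * Q = Q →
        s * n.trace + 2 * k * ((n * P).trace - (n * Q).trace) ≤ 0 := by
      intro s Q hQ hQ2
      have := hn (((lam1 σ + s) • (1 : Mat3) - (2 * k) • Q) - σ) (subset_closure
        ⟨(lam1 σ + s) • (1 : Mat3) - (2 * k) • Q, by rw [hC]; exact proj_eig hk hQ hQ2,
          1, one_pos, by rw [one_smul]⟩)
      have e : ((lam1 σ + s) • (1 : Mat3) - (2 * k) • Q) - σ
          = s • (1 : Mat3) + (2 * k) • P - (2 * k) • Q := by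
        have h1 : (2 * k) • P = lam1 σ • (1 : Mat3) - σ := eq_sub_of_add_eq' (by
          rw [← eq_sub_iff_add_eq]; exact hσ)
        rw [h1, add_smul]; abel
      rw [e] at this
      unfold minner at this
      simp only [mul_add, mul_sub, mul_smul_comm, mul_one, trace_add, trace_sub, trace_smul,
        smul_eq_mul] at this
      linarith
    have htr : n.trace = 0 := by
      have h1 := key 1 P hPs hPP
      have h2 := key (-1) P hPs hPP
      linarith
    have key2 : ∀ Q : Mat3, Q.IsSymm → Q * Q = Q → (n * P).trace ≤ (n * Q).trace := by
      intro Q hQ hQ2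
      have h1 := key 0 Q hQ hQ2
      by_contra hlt
      push Not at hlt
      nlinarith [mul_pos hk (sub_pos.mpr hlt)]
    set c := (n * P).trace with hc
    have hc' : c = v₃ ⬝ᵥ (n *ᵥ v₃) := trace_mul_vv n v₃
    have proj : ∀ x : Fin 3 → ℝ, x ≠ 0 → 0 < x ⬝ᵥ x ∧
        ((x ⬝ᵥ x)⁻¹ • vecMulVec x x) * ((x ⬝ᵥ x)⁻¹ • vecMulVec x x)
          = ((x ⬝ᵥ x)⁻¹ • vecMulVec x x) := by
      intro x hx
      have hpos : 0 < x ⬝ᵥ x := by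
        rcases (show 0 ≤ x ⬝ᵥ x from Finset.sum_nonneg fun i _ => mul_self_nonneg (x i)).lt_or_eq with h | h
        · exact h
        · exact absurd (dotProduct_self_eq_zero.mp h.symm) hx
      refine ⟨hpos, ?_⟩
      rw [smul_mul_smul_comm, vecMulVec_mul_vecMulVec, vecMulVec_smul, smul_smul]
      congr 1
      field_simp
    have ray : (n - c • (1 : Mat3)).PosSemidef := by
      refine PosSemidef.of_dotProduct_mulVec_nonneg
        (symm_herm (hns.sub (symm_one.smul _))) ?_
      intro x
      rw [star_trivial, sub_mulVec, smul_mulVec, one_mulVec, dotProduct_sub, dotProduct_smul,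
        smul_eq_mul]
      by_cases hx : x = 0
      · subst hx; simp
      obtain ⟨hpos, hid⟩ := proj x hx
      have h1 := key2 _ ((vv_symm x).smul _) hid
      rw [mul_smul_comm, trace_smul, trace_mul_vv, smul_eq_mul, inv_mul_eq_div,
        le_div_iff₀ hpos] at h1
      linarith
    have hnv : n *ᵥ v₃ = c • v₃ := by
      have h1 : star v₃ ⬝ᵥ ((n - c • (1 : Mat3)) *ᵥ v₃) = 0 := by
        rw [star_trivial, sub_mulVec, smul_mulVec, one_mulVec, dotProduct_sub, dotProduct_smul,
          smul_eq_mul, hv₃u, ← hc']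
        ring
      have h2 := (ray.dotProduct_mulVec_zero_iff v₃).mp h1
      rw [sub_mulVec, smul_mulVec, one_mulVec] at h2
      exact sub_eq_zero.mp h2
    have hPv : P *ᵥ v₃ = v₃ := by
      rw [hP, vecMulVec_mulVec, hv₃u]; simp
    have hκs : (n - c • P).IsSymm := hns.sub (hPs.smul _)
    have hκv : (n - c • P) *ᵥ v₃ = 0 := by
      rw [sub_mulVec, smul_mulVec, hnv, hPv, sub_self]
    refine ⟨n - c • P, hκs, ?_, hκv, ?_⟩
    · have hnP : n * P = c • P := by rw [hP, mul_vecMulVec, hnv, smul_vecMulVec]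
      refine PosSemidef.of_dotProduct_mulVec_nonneg (symm_herm hκs) ?_
      intro x
      rw [star_trivial]
      set y := x - (v₃ ⬝ᵥ x) • v₃ with hy
      have hyv : v₃ ⬝ᵥ y = 0 := by
        rw [hy, dotProduct_sub, dotProduct_smul, hv₃u]; simp
      have hPy : P *ᵥ y = 0 := by
        rw [hP, vecMulVec_mulVec, hyv]; simp
      have e1 : x ⬝ᵥ ((n - c • P) *ᵥ x) = y ⬝ᵥ (n *ᵥ y) := by
        have hx : x = y + (v₃ ⬝ᵥ x) • v₃ := by rw [hy]; abel
        have h1 : (n - c • P) *ᵥ x = n *ᵥ y := by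
          rw [hx, mulVec_add, mulVec_smul, hκv, sub_mulVec, smul_mulVec, hPy]
          simp
        rw [h1]
        conv_lhs => rw [hx]
        have h2 : v₃ ⬝ᵥ (n *ᵥ y) = 0 := by
          rw [dotProduct_mulVec, ← mulVec_transpose, hns, hnv, smul_dotProduct, hyv, smul_zero]
        rw [add_dotProduct, smul_dotProduct, h2, smul_zero, add_zero]
      rw [e1]
      by_cases hy0 : y = 0
      · rw [hy0]; simp
      obtain ⟨hpos, hid⟩ := proj y hy0
      have hyP : P * ((y ⬝ᵥ y)⁻¹ • vecMulVec y y) = 0 := by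
        rw [mul_smul_comm, mul_vecMulVec, hPy]; simp
      have hPyr : ((y ⬝ᵥ y)⁻¹ • vecMulVec y y) * P = 0 := by
        rw [smul_mul_assoc, vecMulVec_mul, ← mulVec_transpose, hPs, hPy]; simp
      have h1 := key2 (P + (y ⬝ᵥ y)⁻¹ • vecMulVec y y) (hPs.add ((vv_symm y).smul _)) (by
        rw [add_mul, mul_add, mul_add, hid, hPP, hyP, hPyr]; simp)
      rw [mul_add, trace_add, mul_smul_comm, trace_smul, trace_mul_vv n y, smul_eq_mul, ← hc,
        inv_mul_eq_div] at h1
      have h2 : 0 ≤ y ⬝ᵥ (n *ᵥ y) / (y ⬝ᵥ y) := by linarith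
      have h3 := mul_nonneg h2 hpos.le
      rwa [div_mul_cancel₀ _ hpos.ne'] at h3
    · have : P.trace = 1 := by rw [hP, trace_vecMulVec, hv₃u]
      rw [trace_sub, trace_smul, htr, this]
      simp
  · rintro ⟨κ, hκs, hκ, hκv, rfl⟩
    refine ⟨hκs.sub (hPs.smul _), ?_⟩
    have hκP : κ * P = 0 := mul_vv_eq_zero hκv
    have hcl : IsClosed {τ : Mat3 | minner (κ - κ.trace • P) τ ≤ 0} :=
      isClosed_le (minner_cont _) continuous_const
    intro τ hτ
    refine closure_minimal ?_ hcl hτ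
    rintro _ ⟨η, hη, α, hα, rfl⟩
    rw [hC] at hη
    obtain ⟨hηs, hηk⟩ := hη
    have a1 := trace_mul_psd hκ (lam1_psd hηs)
    have a2 : 0 ≤ (P * (η - lam3 η • (1 : Mat3))).trace := by
      refine trace_mul_psd ?_ (lam3_psd hηs)
      have := posSemidef_vecMulVec_self_star v₃
      rwa [star_trivial] at this
    have hPt : P.trace = 1 := by rw [hP, trace_vecMulVec, hv₃u]
    have a3 : (κ * σ).trace = lam1 σ * κ.trace := by
      conv_lhs => rw [hσ]
      rw [mul_sub, mul_smul_comm, mul_smul_comm, hκP, mul_one, smul_zero, sub_zero, trace_smul,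
        smul_eq_mul]
    have a4 : (P * σ).trace = lam3 σ := by
      rw [trace_mul_comm, trace_mul_vv, hv₃, dotProduct_smul, hv₃u, smul_eq_mul, mul_one]
    simp only [mul_sub, mul_smul_comm, mul_one, trace_sub, trace_smul, smul_eq_mul, hPt] at a1 a2
    have hkt := hκ.trace_nonneg
    have e : minner (κ - κ.trace • P) (α • (η - σ)) =
        α * ((κ * η).trace - κ.trace * (P * η).trace - (lam1 σ - lam3 σ) * κ.trace) := by
      unfold minner
      simp only [mul_smul_comm, mul_sub, sub_mul, smul_mul_assoc, trace_smul, trace_sub,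
        smul_eq_mul, a3, a4]
      ring
    change minner (κ - κ.trace • P) (α • (η - σ)) ≤ 0
    rw [e, hσbd]
    refine mul_nonpos_of_nonneg_of_nonpos hα.le ?_
    nlinarith [mul_nonneg hkt a2, mul_nonneg hkt (sub_nonneg.mpr hηk)]
end
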